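/- Let n ≥ 2 and let A be a real n×n N-matrix of the first category such that A = [[A₁₁, A₁₂],[A₂₁, A₂₂]] with A₁₁ of size k×k (k < n), A₁₁ < 0 and A₂₂ < 0 entrywise, and A₁₂ > 0, A₂₁ > 0 entrywise. Partition A as A = [[A', u],[vᵀ, a]] where A' is the leading (n−1)×(n−1) principal submatrix, u, v ∈ ℝⁿ⁻¹ and a ∈ ℝ. Then A' is an N-matrix, a < 0, the first k entries of u and of v are positive, the last n−1−k entries of u and of v are negative, and A' − (1/a)·u·vᵀ is a P-matrix. -/

import Mathlib

open Matrix

/-- A real matrix is an N-matrix if all of its principal minors are negative. -/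
def IsNMatrix {m : Type*} [Fintype m] [DecidableEq m] (A : Matrix m m ℝ) : Prop :=
  ∀ α : Finset m, α.Nonempty →
    (A.submatrix (fun i : α => (i : m)) (fun j : α => (j : m))).det < 0

/-- A real matrix is a P-matrix if all of its principal minors are positive. -/
def IsPMatrix {m : Type*} [Fintype m] [DecidableEq m] (A : Matrix m m ℝ) : Prop :=
  ∀ α : Finset m, α.Nonempty →
    0 < (A.submatrix (fun i : α => (i : m)) (fun j : α => (j : m))).det

theorem IsNMatrix.det_submatrix_neg {m β : Type*} [Fintype m] [DecidableEq m]
    [Fintype β] [DecidableEq β] [Nonempty β] {A : Matrix m m ℝ} (hA : IsNMatrix A)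
    (f : β → m) (hf : Function.Injective f) : (A.submatrix f f).det < 0 := by
  classical
  have h := hA (Finset.univ.image f) (Finset.univ_nonempty.image f)
  let e : β ≃ (Finset.univ.image f : Finset m) :=
    Equiv.ofBijective (fun b => ⟨f b, Finset.mem_image_of_mem f (Finset.mem_univ b)⟩)
      ⟨fun a b hab => hf (congrArg Subtype.val hab), fun ⟨y, hy⟩ => by
        obtain ⟨b, -, hb⟩ := Finset.mem_image.mp hy
        exact ⟨b, Subtype.ext hb⟩⟩
  rw [← Matrix.det_submatrix_equiv_self e] at h
  exact h

/-- An N-matrix of the first category of size `n + 1 ≥ 2` in the block form of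
Theorem 4.3 (diagonal blocks negative, off-diagonal blocks positive, with the
leading block of size `k × k`, `k < n + 1`), partitioned as `A = [[A', u], [vᵀ, a]]`:
then `A'` is an N-matrix, `a < 0`, the first `k` entries of `u` and `v` are
positive, the remaining entries are negative, and `A' - (1/a)·u·vᵀ` is a P-matrix. -/
theorem stmt_12 {n : ℕ} (hn : 1 ≤ n) (A : Matrix (Fin (n + 1)) (Fin (n + 1)) ℝ)
    (hA : IsNMatrix A) (hfc : ∃ i j, 0 < A i j)
    (k : ℕ) (hk : k < n + 1)
    (h11 : ∀ i j : Fin (n + 1), (i : ℕ) < k → (j : ℕ) < k → A i j < 0)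
    (h22 : ∀ i j : Fin (n + 1), k ≤ (i : ℕ) → k ≤ (j : ℕ) → A i j < 0)
    (h12 : ∀ i j : Fin (n + 1), (i : ℕ) < k → k ≤ (j : ℕ) → 0 < A i j)
    (h21 : ∀ i j : Fin (n + 1), k ≤ (i : ℕ) → (j : ℕ) < k → 0 < A i j) :
    IsNMatrix (Matrix.of fun i j : Fin n => A i.castSucc j.castSucc) ∧
    A (Fin.last n) (Fin.last n) < 0 ∧
    (∀ i : Fin n, (i : ℕ) < k → 0 < A i.castSucc (Fin.last n)) ∧
    (∀ i : Fin n, k ≤ (i : ℕ) → A i.castSucc (Fin.last n) < 0) ∧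
    (∀ j : Fin n, (j : ℕ) < k → 0 < A (Fin.last n) j.castSucc) ∧
    (∀ j : Fin n, k ≤ (j : ℕ) → A (Fin.last n) j.castSucc < 0) ∧
    IsPMatrix (Matrix.of fun i j : Fin n =>
      A i.castSucc j.castSucc -
        (1 / A (Fin.last n) (Fin.last n)) *
          (A i.castSucc (Fin.last n) * A (Fin.last n) j.castSucc)) := by
  have ha : A (Fin.last n) (Fin.last n) < 0 :=
    h22 _ _ (by simp; omega) (by simp; omega)
  refine ⟨?_, ha, fun i hi => h12 _ _ (by simpa using hi) (by simp; omega),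
    fun i hi => h22 _ _ (by simpa using hi) (by simp; omega),
    fun i hi => h21 _ _ (by simp; omega) (by simpa using hi),
    fun i hi => h22 _ _ (by simp; omega) (by simpa using hi), ?_⟩
  · intro α hα
    have : Nonempty α := hα.to_subtype
    exact hA.det_submatrix_neg (fun i : α => (i : Fin n).castSucc)
      (fun i j h => Subtype.ext (Fin.castSucc_injective n h))
  · intro α hα
    let f : α ⊕ Unit → Fin (n + 1) := Sum.elim (fun i => (i : Fin n).castSucc) (fun _ => Fin.last n)
    have hf : Function.Injective f := by
      rintro (i | i) (j | j) h
      · exact congrArg Sum.inl (Subtype.ext (Fin.castSucc_injective n h))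
      · exact absurd h (Fin.castSucc_lt_last _).ne
      · exact absurd h.symm (Fin.castSucc_lt_last _).ne
      · rfl
    have h := hA.det_submatrix_neg f hf
    let D : Matrix Unit Unit ℝ := Matrix.of fun _ _ => A (Fin.last n) (Fin.last n)
    let E : Matrix Unit Unit ℝ := Matrix.of fun _ _ => (A (Fin.last n) (Fin.last n))⁻¹
    let _ : Invertible D := ⟨E, by ext; simp [D, E, Matrix.mul_apply, ha.ne],
      by ext; simp [D, E, Matrix.mul_apply, ha.ne]⟩
    have hE : ⅟D = E := rfl
    have hb : A.submatrix f f = Matrix.fromBlocks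
        (Matrix.of fun i j : α => A (i : Fin n).castSucc (j : Fin n).castSucc)
        (Matrix.of fun (i : α) (_ : Unit) => A (i : Fin n).castSucc (Fin.last n))
        (Matrix.of fun (_ : Unit) (j : α) => A (Fin.last n) (j : Fin n).castSucc) D := by
      ext (i | i) (j | j) <;> rfl
    rw [hb, Matrix.det_fromBlocks₂₂, hE] at h
    have hD : D.det = A (Fin.last n) (Fin.last n) := by simp [D]
    rw [hD] at h
    have h' := pos_of_mul_neg_right h ha.le
    refine lt_of_lt_of_eq h' (congrArg Matrix.det ?_)
    ext i j
    simp [E, Matrix.mul_apply]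
    ring
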